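/- Let C¹, C², …, C^m be n×n real symmetric matrices with m ≥ 3 and C¹ nonsingular. Suppose that for each i ∈ {2,…,m} the matrix (C¹)⁻¹Cⁱ is real similarly diagonalizable, and that Cʲ(C¹)⁻¹Cⁱ is real symmetric for all 2 ≤ i < j ≤ m. Then there exists a nonsingular real matrix R such that RᵀC¹R = diag(A₁, A₂, …, A_r) and RᵀCⁱR = diag(αⁱ₁A₁, αⁱ₂A₂, …, αⁱ_rA_r) for every i ∈ {2,…,m}, where the A_t are nonsingular real symmetric matrices and the αⁱ_t are real numbers. -/

import Mathlib

open Matrix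

/-- A real square matrix is real similarly diagonalizable if there exists a nonsingular
real matrix `Q` such that `Q⁻¹ A Q` is diagonal. -/
def SimilarlyDiagonalizable {n : ℕ} (A : Matrix (Fin n) (Fin n) ℝ) : Prop :=
  ∃ Q : Matrix (Fin n) (Fin n) ℝ, IsUnit Q ∧ (Q⁻¹ * A * Q).IsDiag

/-- The maximal generalized eigenspaces of a similarly diagonalizable matrix are its eigenspaces,
and these span the whole space. -/
lemma SimilarlyDiagonalizable.maxGenEigenspace_eq_and_iSup_eq_top {n : ℕ}
    {A : Matrix (Fin n) (Fin n) ℝ} (hA : SimilarlyDiagonalizable A) :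
    (∀ μ : ℝ, Module.End.maxGenEigenspace (toLin' A) μ = Module.End.eigenspace (toLin' A) μ) ∧
      ⨆ μ : ℝ, Module.End.eigenspace (toLin' A) μ = ⊤ := by
  obtain ⟨Q, hQ, hD⟩ := hA
  have hdet : IsUnit Q.det := (isUnit_iff_isUnit_det Q).mp hQ
  set d := (Q⁻¹ * A * Q).diag
  have hAQ : A * Q = Q * diagonal d := by
    rw [hD.diagonal_diag, mul_assoc, mul_nonsing_inv_cancel_left _ _ hdet]
  let b : Module.Basis (Fin n) ℝ (Fin n → ℝ) :=
    basisOfLinearIndependentOfCardEqFinrank' Q.col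
      (linearIndependent_cols_iff_isUnit.mpr hQ) (by simp)
  have hb : ∀ k, b k = Q.col k := fun k => by simp [b]
  have hlin : toLin' A = toLin b b (diagonal d) := by
    refine b.ext fun k => ?_
    have hk : A *ᵥ Q.col k = d k • Q.col k := by
      ext i
      have := congrFun (congrFun hAQ i) k
      rw [mul_diagonal, mul_comm] at this
      simpa [mul_apply, mulVec, dotProduct] using this
    rw [toLin_self, toLin'_apply, hb, hk]
    simp [diagonal_apply, hb]
  rw [hlin]
  exact ⟨fun μ => maxGenEigenspace_toLin_diagonal_eq_eigenspace d b,
    iSup_eigenspace_toLin_diagonal_eq_top d b⟩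

/-- Pairwise commuting similarly diagonalizable matrices have a common basis of eigenvectors. -/
lemma exists_basis_common_eigenvectors {n : ℕ} {ι : Type*}
    (M : ι → Matrix (Fin n) (Fin n) ℝ) (hM : ∀ i, SimilarlyDiagonalizable (M i))
    (hcomm : Pairwise fun i j => Commute (M i) (M j)) :
    ∃ (v : Module.Basis (Fin n) ℝ (Fin n → ℝ)) (χ : Fin n → ι → ℝ),
      ∀ k i, M i *ᵥ v k = χ k i • v k := by
  have htop := Module.End.iSup_iInf_maxGenEigenspace_eq_top_of_iSup_maxGenEigenspace_eq_top_of_commute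
    (fun i => toLin' (M i))
    (fun i j hij => (hcomm hij).map (toLinAlgEquiv' (R := ℝ)))
    (fun i => by
      simp_rw [(hM i).maxGenEigenspace_eq_and_iSup_eq_top.1]
      exact (hM i).maxGenEigenspace_eq_and_iSup_eq_top.2)
  rw [Submodule.iSup_eq_span] at htop
  let w := Module.Basis.ofSpan htop.ge
  have hw : ∀ k, ∃ χ : ι → ℝ, ∀ i, M i *ᵥ w k = χ i • w k := fun k => by
    obtain ⟨χ, hχ⟩ := Set.mem_iUnion.mp (Module.Basis.ofSpan_subset htop.ge (Set.mem_range_self k))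
    refine ⟨χ, fun i => ?_⟩
    have hi := (Submodule.mem_iInf _).mp hχ i
    rw [(hM i).maxGenEigenspace_eq_and_iSup_eq_top.1, Module.End.mem_eigenspace_iff] at hi
    exact hi
  choose χ hχ using hw
  have e := w.indexEquiv (Pi.basisFun ℝ (Fin n))
  exact ⟨w.reindex e, fun k => χ (e.symm k), fun k i => by simpa using hχ (e.symm k) i⟩

/-- The indices in `Fin n` can be grouped into blocks according to the value of a function. -/
lemma exists_sigma_equiv_fibers {n : ℕ} {K : Type*} (χ : Fin n → K) :
    ∃ (r : ℕ) (msz : Fin r → ℕ) (e : (Σ t : Fin r, Fin (msz t)) ≃ Fin n) (c : Fin r → K),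
      Function.Injective c ∧ ∀ s, χ (e s) = c s.1 := by
  classical
  let eS : Fin (Fintype.card (Set.range χ)) ≃ Set.range χ := (Fintype.equivFin _).symm
  let g : Fin n → Fin (Fintype.card (Set.range χ)) := fun k => eS.symm ⟨χ k, k, rfl⟩
  let e := (Equiv.sigmaCongrRight fun t =>
    (Fintype.equivFin {k // g k = t}).symm).trans (Equiv.sigmaFiberEquiv g)
  refine ⟨_, _, e, fun t => eS t, Subtype.val_injective.comp eS.injective, fun s => ?_⟩
  have h : g (e s) = s.1 := ((Fintype.equivFin {k // g k = s.1}).symm s.2).2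
  rw [← h]
  simp [g]

/-- The blocks of an invertible block diagonal matrix are invertible. -/
lemma isUnit_of_isUnit_blockDiagonal' {o R : Type*} {m' : o → Type*} [CommRing R] [Fintype o]
    [DecidableEq o] [∀ t, Fintype (m' t)] [∀ t, DecidableEq (m' t)]
    {A : ∀ t, Matrix (m' t) (m' t) R} (h : IsUnit (blockDiagonal' A)) (t : o) : IsUnit (A t) := by
  obtain ⟨N, hN⟩ := h.exists_right_inv
  refine IsUnit.of_mul_eq_one (blockDiag' N t) ?_
  ext i j
  have := congrFun (congrFun hN ⟨t, i⟩) ⟨t, j⟩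
  rw [mul_apply, Fintype.sum_sigma, Finset.sum_eq_single t] at this
  · simpa [mul_apply, blockDiag'_apply, one_apply] using this
  · intro s _ hs
    simp [blockDiagonal'_apply_ne _ _ _ hs.symm]
  · simp

/-- Let `C¹, …, C^m` be `n × n` real symmetric matrices, `m ≥ 3`, `C¹`
nonsingular (the collection is indexed by `i ∈ {1, …, m}`).  Suppose `(C¹)⁻¹ Cⁱ` is real
similarly diagonalizable for each `i ∈ {2, …, m}` and `Cʲ (C¹)⁻¹ Cⁱ` is real symmetric for
all `2 ≤ i < j ≤ m`.  Then there is a nonsingular real matrix `R` with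
`Rᵀ C¹ R = diag(A₁, …, A_r)` and `Rᵀ Cⁱ R = diag(αⁱ₁ A₁, …, αⁱ_r A_r)` for every
`i ∈ {2, …, m}`, where the `A_t` are nonsingular real symmetric matrices and the `αⁱ_t`
are real numbers (the identification of the block index set with `Fin n` is recorded by
an equivalence `e`). -/
theorem stmt_6 {n m : ℕ} (hm : 3 ≤ m) (C : ℕ → Matrix (Fin n) (Fin n) ℝ)
    (hsymm : ∀ i, 1 ≤ i → i ≤ m → (C i).IsSymm)
    (h1 : IsUnit (C 1))
    (hdiag : ∀ i, 2 ≤ i → i ≤ m → SimilarlyDiagonalizable ((C 1)⁻¹ * C i))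
    (hsym2 : ∀ i j, 2 ≤ i → i < j → j ≤ m → (C j * ((C 1)⁻¹ * C i)).IsSymm) :
    ∃ (r : ℕ) (msz : Fin r → ℕ) (_ : ∑ t, msz t = n)
      (e : (Σ t : Fin r, Fin (msz t)) ≃ Fin n)
      (R : Matrix (Fin n) (Fin n) ℝ) (_ : IsUnit R)
      (A : ∀ t : Fin r, Matrix (Fin (msz t)) (Fin (msz t)) ℝ)
      (α : ℕ → Fin r → ℝ),
      (∀ t, (A t).IsSymm ∧ IsUnit (A t)) ∧
      Rᵀ * C 1 * R = Matrix.reindex e e (Matrix.blockDiagonal' A) ∧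
      (∀ i, 2 ≤ i → i ≤ m →
        Rᵀ * C i * R = Matrix.reindex e e (Matrix.blockDiagonal' fun t => α i t • A t)) := by
  have hdet : IsUnit (C 1).det := (isUnit_iff_isUnit_det _).mp h1
  have hs1 : (C 1)ᵀ = C 1 := hsymm 1 le_rfl (by omega)
  have hlt : ∀ i j, 2 ≤ i → i < j → j ≤ m → Commute ((C 1)⁻¹ * C i) ((C 1)⁻¹ * C j) := by
    intro i j hi hij hj
    have h := (hsym2 i j hi hij hj).eq
    rw [transpose_mul, transpose_mul, transpose_nonsing_inv, hs1, (hsymm i (by omega) (by omega)).eq,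
      (hsymm j (by omega) hj).eq] at h
    rw [Commute, SemiconjBy, mul_assoc, mul_assoc, ← h, mul_assoc]
  obtain ⟨v, χ, hv⟩ := exists_basis_common_eigenvectors
    (fun i : Set.Icc 2 m => (C 1)⁻¹ * C i) (fun i => hdiag i i.2.1 i.2.2) fun i j hij => by
      rcases lt_or_gt_of_ne (Subtype.coe_injective.ne hij) with h | h
      · exact hlt i j i.2.1 h j.2.2
      · exact (hlt j i j.2.1 h i.2.2).symm
  let R : Matrix (Fin n) (Fin n) ℝ := of fun i k => v k i
  have hR : IsUnit R := linearIndependent_cols_iff_isUnit.mp v.linearIndependent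
  have hright : ∀ (i : Set.Icc 2 m) k l, (Rᵀ * C i * R) k l = χ l i * (Rᵀ * C 1 * R) k l := by
    intro i k l
    have hCR : C i * R = C 1 * R * diagonal fun l => χ l i := by
      ext p q
      have h := congrArg (C 1 *ᵥ ·) (hv q i)
      simp only [mulVec_mulVec, mul_nonsing_inv_cancel_left _ _ hdet, mulVec_smul] at h
      rw [mul_diagonal, mul_comm]
      simpa [mul_apply, mulVec, dotProduct, R] using congrFun h p
    rw [mul_assoc, hCR, ← mul_assoc, mul_diagonal, ← mul_assoc, mul_comm]
  have hsB : ∀ i, 1 ≤ i → i ≤ m → ∀ k l, (Rᵀ * C i * R) k l = (Rᵀ * C i * R) l k := by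
    intro i hi hi' k l
    have h : (Rᵀ * C i * R).IsSymm := by
      simp [Matrix.IsSymm, transpose_mul, (hsymm i hi hi').eq, mul_assoc]
    exact h.apply l k
  have hoff : ∀ k l, χ k ≠ χ l → (Rᵀ * C 1 * R) k l = 0 := by
    intro k l hkl
    obtain ⟨i, hi⟩ := Function.ne_iff.mp hkl
    have h := hright i l k
    rw [hsB i (by have := i.2.1; omega) i.2.2, hsB 1 le_rfl (by omega) l k, hright i k l] at h
    exact (mul_eq_mul_right_iff.mp h).resolve_left (Ne.symm hi)
  obtain ⟨r, msz, e, c, hc, he⟩ := exists_sigma_equiv_fibers χ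
  let A : ∀ t, Matrix (Fin (msz t)) (Fin (msz t)) ℝ := fun t =>
    of fun k l => (Rᵀ * C 1 * R) (e ⟨t, k⟩) (e ⟨t, l⟩)
  have hB1 : Rᵀ * C 1 * R = reindex e e (blockDiagonal' A) := by
    rw [← Equiv.symm_apply_eq]
    ext ⟨s, k⟩ ⟨t, l⟩
    by_cases hst : s = t
    · subst hst
      simp [A, blockDiagonal'_apply_eq]
    · rw [blockDiagonal'_apply_ne _ _ _ hst]
      exact hoff _ _ (by simpa [he] using hc.ne hst)
  have hunit : IsUnit (blockDiagonal' A) := by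
    have h : IsUnit (Rᵀ * C 1 * R) := ((R.isUnit_transpose.mpr hR).mul h1).mul hR
    rw [hB1] at h
    simpa using h
  refine ⟨r, msz, by simpa using Fintype.card_congr e, e, R, hR, A,
    fun i t => if hi : i ∈ Set.Icc 2 m then c t ⟨i, hi⟩ else 0,
    fun t => ⟨Matrix.IsSymm.ext fun k l => hsB 1 le_rfl (by omega) _ _,
      isUnit_of_isUnit_blockDiagonal' hunit t⟩, hB1, fun i hi hi' => ?_⟩
  rw [← Equiv.symm_apply_eq]
  ext ⟨s, k⟩ ⟨t, l⟩
  refine (hright ⟨i, hi, hi'⟩ _ _).trans ?_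
  rw [he, hB1]
  by_cases hst : s = t
  · subst hst
    simp [blockDiagonal'_apply_eq, hi, hi']
  · simp [blockDiagonal'_apply_ne _ _ _ hst]
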